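/- Suppose each u_i (i ∈ 𝔠) is locally Lipschitz in (λ,ω) and satisfies for all (λ,ω): (ω_i − ω^∞)·u_i(λ,ω,p) ≤ 0 whenever ω_i ≠ ω^∞, and u_i(λ,ω,p) = 0 whenever ω_i = ω^∞. Let β > 1 and let (λ(·),ω(·)) be the solution of the closed-loop swing dynamics with λ(0) ∈ range(D) and (λ(0),ω(0)) ∈ Φ. Then (λ(t),ω(t)) → (λ^∞, ω^∞·1_n) as t → ∞. -/

import Mathlib

open Real BigOperators

section Asymptotics

open Filter Topology Set

/-- If `f` converges at infinity, `f' ≤ -g + e` with `e → 0` and `g` is Lipschitz on `[0, ∞)`,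
then `g` is eventually smaller than any positive number. -/
theorem eventually_lt_of_deriv_le_neg_add {f f' g e : ℝ → ℝ} {L K : ℝ}
    (hf : ∀ t ≥ 0, HasDerivAt f (f' t) t) (hL : Tendsto f atTop (𝓝 L))
    (hle : ∀ t ≥ 0, f' t ≤ -g t + e t) (he : Tendsto e atTop (𝓝 0))
    (hg : ∀ s ≥ 0, ∀ t ≥ 0, |g t - g s| ≤ K * |t - s|) {ε : ℝ} (hε : 0 < ε) :
    ∀ᶠ t in atTop, g t < ε := by
  obtain ⟨δ, hδ, hKδ⟩ : ∃ δ > 0, K * δ ≤ ε / 3 := by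
    refine ⟨ε / (3 * (|K| + 1)), by positivity, ?_⟩
    rw [mul_div_assoc', div_le_div_iff₀ (by positivity) (by norm_num)]
    nlinarith [le_abs_self K, abs_nonneg K]
  have hdiff : Tendsto (fun t => f t - f (t + δ)) atTop (𝓝 0) := by
    simpa using hL.sub (hL.comp (tendsto_atTop_add_const_right atTop δ tendsto_id))
  have he' : ∀ᶠ s in atTop, e s < ε / 3 := he.eventually_lt_const (by positivity)
  filter_upwards [eventually_forall_ge_atTop.2 he',
    hdiff.eventually_lt_const (show 0 < δ * (ε / 3) by positivity), eventually_ge_atTop 0] with t het hft ht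
  obtain ⟨ξ, hξ, hξf⟩ := exists_hasDerivAt_eq_slope f f' (show t < t + δ by linarith)
    (fun s hs => (hf s (ht.trans hs.1)).continuousAt.continuousWithinAt)
    (fun s hs => hf s (ht.trans hs.1.le))
  have hξ0 : 0 ≤ ξ := ht.trans hξ.1.le
  have h1 : g t - g ξ ≤ ε / 3 := by
    have hK : 0 ≤ K := by
      have := (abs_nonneg _).trans (hg 0 le_rfl 1 zero_le_one)
      simpa using this
    refine (le_abs_self _).trans ((hg ξ hξ0 t ht).trans (le_trans ?_ hKδ))
    refine mul_le_mul_of_nonneg_left ?_ hK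
    rw [abs_le]
    constructor <;> linarith [hξ.1, hξ.2]
  have h2 : -f' ξ < ε / 3 := by
    rw [hξf, ← neg_div, add_sub_cancel_left, div_lt_iff₀ hδ]
    linarith
  linarith [hle ξ hξ0, het ξ hξ.1.le]

/-- A real function whose derivative is a continuous function of a state that stays in a compact
set is Lipschitz on `[0, ∞)`. -/
theorem exists_lipschitz_of_deriv_eq_comp {X : Type*} [TopologicalSpace X] {S : Set X}
    (hS : IsCompact S) {x : ℝ → X} (hx : ∀ t ≥ 0, x t ∈ S) {G : X → ℝ} (hG : Continuous G)
    {f : ℝ → ℝ} (hf : ∀ t ≥ 0, HasDerivAt f (G (x t)) t) :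
    ∃ K, ∀ s ≥ 0, ∀ t ≥ 0, |f t - f s| ≤ K * |t - s| := by
  obtain ⟨K, hK⟩ := hS.exists_bound_of_continuousOn hG.continuousOn
  refine ⟨K, fun s hs t ht => ?_⟩
  exact (convex_Ici (0 : ℝ)).norm_image_sub_le_of_norm_hasDerivWithin_le
    (fun r hr => (hf r hr).hasDerivWithinAt) (fun r hr => hK _ (hx r hr)) hs ht

/-- If `G` vanishes on `K × {y₀}` with `K` compact, then `G (x t) (y t) → 0` whenever `x t ∈ K`
and `y t → y₀`. -/
theorem tendsto_zero_of_isCompact_of_vanish {α X Y : Type*} [TopologicalSpace X]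
    [TopologicalSpace Y] {l : Filter α} {K : Set X} (hK : IsCompact K) {y₀ : Y}
    {G : X × Y → ℝ} (hG : Continuous G) (hG0 : ∀ x, G (x, y₀) = 0) {x : α → X} {y : α → Y}
    (hx : ∀ᶠ t in l, x t ∈ K) (hy : Tendsto y l (𝓝 y₀)) :
    Tendsto (fun t => G (x t, y t)) l (𝓝 0) := by
  rw [Metric.tendsto_nhds]
  intro ε hε
  have hev : ∀ᶠ z in 𝓝 y₀, ∀ w ∈ K, dist (G (w, z)) 0 < ε := by
    refine hK.eventually_forall_of_forall_eventually fun w _ => ?_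
    have : Tendsto (fun q : Y × X => G (q.2, q.1)) (𝓝 (y₀, w)) (𝓝 0) := by
      have hc : Continuous fun q : Y × X => G (q.2, q.1) := by fun_prop
      simpa [hG0] using hc.tendsto (y₀, w)
    exact Metric.tendsto_nhds.1 this ε hε
  filter_upwards [hx, hy.eventually hev] with t h1 h2 using h2 _ h1

/-- A function that is differentiable with nonpositive derivative on `[0, ∞)` and bounded below
there converges at infinity. -/
theorem exists_tendsto_of_deriv_nonpos {f f' : ℝ → ℝ} {b : ℝ}
    (hf : ∀ t ≥ 0, HasDerivAt f (f' t) t) (hf' : ∀ t ≥ 0, f' t ≤ 0) (hb : ∀ t ≥ 0, b ≤ f t) :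
    ∃ L, Tendsto f atTop (𝓝 L) := by
  have hanti : AntitoneOn f (Ici 0) := by
    refine antitoneOn_of_hasDerivWithinAt_nonpos (f' := f') (convex_Ici 0)
      (fun t ht => (hf t ht).continuousAt.continuousWithinAt) ?_ ?_ <;>
    · intro t ht
      rw [interior_Ici] at ht
      first
      | exact (hf t ht.le).hasDerivWithinAt
      | exact hf' t ht.le
  have hanti' : Antitone fun t => f (max t 0) := fun s t hst =>
    hanti (mem_Ici.2 (le_max_right _ _)) (mem_Ici.2 (le_max_right _ _)) (max_le_max_right 0 hst)
  refine ⟨_, (tendsto_atTop_ciInf hanti'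
    ⟨b, by rintro _ ⟨t, rfl⟩; exact hb _ (le_max_right _ _)⟩).congr' ?_⟩
  filter_upwards [eventually_ge_atTop 0] with t ht
  simp [ht]

/-- The cosine lies strictly below its tangent lines on `[-π/2, π/2]`. -/
theorem cos_tangent_gap_pos {a x : ℝ} (ha : |a| < π / 2) (hx : |x| ≤ π / 2) (hxa : x ≠ a) :
    0 < cos a - cos x - x * sin a + a * sin a := by
  rw [abs_lt] at ha
  rw [abs_le] at hx
  have hc : ∀ y, HasDerivAt cos (-sin y) y := hasDerivAt_cos
  rcases lt_or_gt_of_ne hxa with h | h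
  · obtain ⟨ξ, hξ, he⟩ := exists_hasDerivAt_eq_slope cos (fun y => -sin y) h
      continuous_cos.continuousOn (fun y _ => hc y)
    have hs : sin ξ < sin a := sin_lt_sin_of_lt_of_le_pi_div_two (by linarith [hξ.1])
      (by linarith) hξ.2
    rw [eq_div_iff (by linarith)] at he
    nlinarith
  · obtain ⟨ξ, hξ, he⟩ := exists_hasDerivAt_eq_slope cos (fun y => -sin y) h
      continuous_cos.continuousOn (fun y _ => hc y)
    have hs : sin a < sin ξ := sin_lt_sin_of_lt_of_le_pi_div_two (by linarith)
      (by linarith [hξ.2]) hξ.1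
    rw [eq_div_iff (by linarith)] at he
    nlinarith

theorem cos_tangent_gap_nonneg {a x : ℝ} (ha : |a| < π / 2) (hx : |x| ≤ π / 2) :
    0 ≤ cos a - cos x - x * sin a + a * sin a := by
  rcases eq_or_ne x a with rfl | h
  · simp
  · exact (cos_tangent_gap_pos ha hx h).le

/-- A differentiable curve starting in a subspace, with velocity in that subspace, stays in it. -/
theorem mem_submodule_of_hasDerivAt {F : Type*} [NormedAddCommGroup F] [NormedSpace ℝ F]
    [FiniteDimensional ℝ F] {P : Submodule ℝ F} {x v : ℝ → F}
    (hx : ∀ t ≥ 0, HasDerivAt x (v t) t) (hv : ∀ t ≥ 0, v t ∈ P) (h0 : x 0 ∈ P) :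
    ∀ t ≥ 0, x t ∈ P := by
  intro t ht
  by_contra hmem
  obtain ⟨φ, hφ, hP⟩ := Submodule.exists_le_ker_of_notMem hmem
  have hd : ∀ s ≥ 0, HasDerivAt (fun r => φ (x r)) 0 s := fun s hs => by
    have h := φ.toContinuousLinearMap.hasFDerivAt.comp_hasDerivAt s (hx s hs)
    rwa [LinearMap.coe_toContinuousLinearMap', hP (hv s hs)] at h
  have h := (convex_Ici (0 : ℝ)).norm_image_sub_le_of_norm_hasDerivWithin_le (C := 0)
    (fun r hr => (hd r hr).hasDerivWithinAt) (fun _ _ => norm_zero.le) self_mem_Ici ht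
  rw [zero_mul, norm_le_zero_iff, sub_eq_zero] at h
  exact hφ (h.trans (hP h0))

/-- A continuous curve on `[0, ∞)` that starts in a closed set and never meets its frontier stays
in that set. -/
theorem mem_of_forall_notMem_frontier {X : Type*} [TopologicalSpace X] {S : Set X}
    (hS : IsClosed S) {x : ℝ → X} (hx : ContinuousOn x (Ici 0)) (h0 : x 0 ∈ S)
    (hf : ∀ t ≥ 0, x t ∉ frontier S) : ∀ t ≥ 0, x t ∈ S := by
  have hint : ∀ t ≥ 0, x t ∈ S → x t ∈ interior S := fun t ht hm => by
    by_contra hn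
    exact hf t ht (hS.frontier_eq ▸ ⟨hm, hn⟩)
  have hsub : x '' Ici 0 ⊆ interior S := by
    refine (isPreconnected_Ici.image x hx).subset_left_of_subset_union isOpen_interior
      hS.isOpen_compl (disjoint_compl_right.mono_left interior_subset) ?_
      ⟨x 0, mem_image_of_mem x self_mem_Ici, hint 0 le_rfl h0⟩
    rintro _ ⟨t, ht, rfl⟩
    by_cases hm : x t ∈ S
    · exact Or.inl (hint t ht hm)
    · exact Or.inr hm
  exact fun t ht => interior_subset (hsub (mem_image_of_mem x ht))

end Asymptotics

section SwingDynamics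

open Filter Topology Set

variable {n m : ℕ} {D : Matrix (Fin m) (Fin n) ℝ} {Yb : Fin m → ℝ} {M E p : Fin n → ℝ}
  {ωinf : ℝ} {lamInf : Fin m → ℝ}

theorem incidence_row_sum_eq_zero
    (hD : ∀ k : Fin m, ∃ i j : Fin n, i ≠ j ∧ D k i = 1 ∧ D k j = -1 ∧
      ∀ l, l ≠ i → l ≠ j → D k l = 0) (k : Fin m) : ∑ i, D k i = 0 := by
  obtain ⟨i, j, hij, hi, hj, h⟩ := hD k
  rw [Fintype.sum_eq_add i j hij fun l hl => h l hl.1 hl.2, hi, hj]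
  norm_num

/-- The dissipation identity along a solution of the swing dynamics, with control input `v`. -/
theorem hasDerivAt_energy (hM : ∀ i, 0 < M i) (hD : ∀ k, ∑ i, D k i = 0)
    (heq : ∀ i, p i - ωinf * E i = ∑ j, D j i * Yb j * sin (lamInf j))
    {lam : ℝ → Fin m → ℝ} {ω : ℝ → Fin n → ℝ} {v : Fin n → ℝ} {t : ℝ}
    (hlam : HasDerivAt lam (D.mulVec (ω t)) t)
    (hω : ∀ i, HasDerivAt (fun s => ω s i)
      ((-E i * ω t i - (∑ j, D j i * Yb j * sin (lam t j)) + p i + v i) / M i) t) :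
    HasDerivAt (fun s => (1 / 2) * ∑ i, M i * (ω s i - ωinf) ^ 2
        + ∑ j, Yb j * (cos (lamInf j) - cos (lam s j)
            - lam s j * sin (lamInf j) + lamInf j * sin (lamInf j)))
      (∑ i, (-(E i * (ω t i - ωinf) ^ 2) + (ω t i - ωinf) * v i)) t := by
  have hlam' := hasDerivAt_pi.1 hlam
  have h1 := (HasDerivAt.fun_sum (u := Finset.univ) fun i _ =>
    (((hω i).sub_const ωinf).pow 2).const_mul (M i)).const_mul (1 / 2)
  have h2 := HasDerivAt.fun_sum (u := Finset.univ) fun j _ =>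
    ((((hlam' j).cos.const_sub (cos (lamInf j))).sub
      ((hlam' j).mul_const (sin (lamInf j)))).add_const (lamInf j * sin (lamInf j))).const_mul (Yb j)
  refine (h1.add h2).congr_deriv ?_
  have hflow : ∑ i, (ω t i - ωinf) * ∑ j, D j i * Yb j * (sin (lam t j) - sin (lamInf j))
      = ∑ j, Yb j * (sin (lam t j) - sin (lamInf j)) * (D.mulVec (ω t)) j := by
    simp_rw [Finset.mul_sum]
    rw [Finset.sum_comm]
    refine Finset.sum_congr rfl fun j _ => ?_
    have hj : (D.mulVec (ω t)) j = ∑ i, D j i * (ω t i - ωinf) := by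
      simp_rw [mul_sub]
      rw [Finset.sum_sub_distrib, ← Finset.sum_mul, hD j, zero_mul, sub_zero]
      rfl
    rw [hj, Finset.mul_sum]
    exact Finset.sum_congr rfl fun i _ => by ring
  have hkin : ∀ i, M i * (2 * (ω t i - ωinf) *
      ((-E i * ω t i - (∑ j, D j i * Yb j * sin (lam t j)) + p i + v i) / M i))
      = 2 * (-(E i * (ω t i - ωinf) ^ 2) + (ω t i - ωinf) * v i
        - (ω t i - ωinf) * ∑ j, D j i * Yb j * (sin (lam t j) - sin (lamInf j))) := by
    intro i
    have hMi := (hM i).ne'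
    simp_rw [mul_sub, Finset.sum_sub_distrib, ← heq]
    field_simp
    ring
  have hpot : ∀ j, Yb j * (-(-sin (lam t j) * (D.mulVec (ω t)) j)
      - (D.mulVec (ω t)) j * sin (lamInf j))
      = Yb j * (sin (lam t j) - sin (lamInf j)) * (D.mulVec (ω t)) j := fun j => by ring
  simp only [Nat.cast_ofNat, Nat.add_one_sub_one, pow_one, hkin, hpot, ← Finset.mul_sum,
    Finset.sum_sub_distrib, hflow]
  ring

/-- If a converging function decreases at rate at least `e * (w - a) ^ 2` along a bounded trajectory,
and the derivative of `w` is a continuous function of the state, then `w` tends to `a`. -/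
theorem tendsto_of_dissipation {X : Type*} [TopologicalSpace X] {S : Set X} (hS : IsCompact S)
    {x : ℝ → X} (hx : ∀ t ≥ 0, x t ∈ S) {w F : X → ℝ} (hw : Continuous w) (hF : Continuous F)
    (hderiv : ∀ t ≥ 0, HasDerivAt (fun s => w (x s)) (F (x t)) t)
    {e a L : ℝ} (he : 0 < e) {f f' : ℝ → ℝ} (hf : ∀ t ≥ 0, HasDerivAt f (f' t) t)
    (hL : Tendsto f atTop (𝓝 L)) (hle : ∀ t ≥ 0, f' t ≤ -(e * (w (x t) - a) ^ 2)) :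
    Tendsto (fun t => w (x t)) atTop (𝓝 a) := by
  have hg : ∀ t ≥ 0, HasDerivAt (fun s => e * (w (x s) - a) ^ 2)
      (e * (2 * (w (x t) - a) * F (x t))) t := fun t ht => by
    simpa using (((hderiv t ht).sub_const a).pow 2).const_mul e
  obtain ⟨K, hK⟩ := exists_lipschitz_of_deriv_eq_comp hS hx
    (G := fun y => e * (2 * (w y - a) * F y)) (by fun_prop) hg
  rw [Metric.tendsto_nhds]
  intro ε hε
  have hev := eventually_lt_of_deriv_le_neg_add hf hL (fun t ht => by simpa using hle t ht)
    tendsto_const_nhds hK (show 0 < e * ε ^ 2 by positivity)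
  filter_upwards [hev] with t ht
  rw [Real.dist_eq]
  exact abs_lt_of_sq_lt_sq (lt_of_mul_lt_mul_left ht he.le) hε.le

end SwingDynamics

/-- Convergence of the closed-loop swing dynamics to the equilibrium
`(λ∞, ω∞·1)` from any admissible initial condition in `Φ`, for locally
Lipschitz controllers satisfying the stabilizing sign constraints. -/
theorem solution_converges_to_equilibrium
    (n m : ℕ)
    (D : Matrix (Fin m) (Fin n) ℝ)
    (hD : ∀ k : Fin m, ∃ i j : Fin n, i ≠ j ∧ D k i = 1 ∧ D k j = -1 ∧
      ∀ l, l ≠ i → l ≠ j → D k l = 0)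
    (Yb : Fin m → ℝ) (hYb : ∀ j, 0 < Yb j)
    (M E : Fin n → ℝ) (hM : ∀ i, 0 < M i) (hE : ∀ i, 0 < E i)
    (p : Fin n → ℝ) (C : Set (Fin n))
    (u : Fin n → (Fin m → ℝ) → (Fin n → ℝ) → (Fin n → ℝ) → ℝ)
    (hu0 : ∀ i ∉ C, ∀ lam ω q, u i lam ω q = 0)
    (ωinf : ℝ) (hωinf : ωinf = (∑ i, p i) / (∑ i, E i))
    (lamInf : Fin m → ℝ) (hrange : ∃ θ, D.mulVec θ = lamInf)
    (hbound : ∀ j, |lamInf j| < π / 2)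
    (heq : ∀ i, p i - ωinf * E i = ∑ j, D j i * Yb j * Real.sin (lamInf j))
    -- `λ∞` is the unique such point in `Γ_cl ∩ range(D)`
    (huniq : ∀ lam' : Fin m → ℝ, (∀ j, |lam' j| ≤ π / 2) → (∃ θ, D.mulVec θ = lam') →
      (∀ i, p i - ωinf * E i = ∑ j, D j i * Yb j * Real.sin (lam' j)) → lam' = lamInf)
    -- the controllers are locally Lipschitz in the state
    (huLip : ∀ i ∈ C, LocallyLipschitz
      (fun x : (Fin m → ℝ) × (Fin n → ℝ) => u i x.1 x.2 p))
    -- stabilizing sign constraints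
    (huSign : ∀ i ∈ C, ∀ (lam : Fin m → ℝ) (ω : Fin n → ℝ),
      (ω i ≠ ωinf → (ω i - ωinf) * u i lam ω p ≤ 0) ∧
      (ω i = ωinf → u i lam ω p = 0))
    -- the energy function, the closed region, the level constant and `Φ`
    (V : (Fin m → ℝ) → (Fin n → ℝ) → ℝ)
    (hV : V = fun lam ω =>
      (1 / 2) * ∑ i, M i * (ω i - ωinf) ^ 2
        + ∑ j, Yb j * (Real.cos (lamInf j) - Real.cos (lam j)
            - lam j * Real.sin (lamInf j) + lamInf j * Real.sin (lamInf j)))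
    (Γcl : Set (Fin m → ℝ)) (hΓcl : Γcl = {lam | ∀ j, |lam j| ≤ π / 2})
    (c : ℝ) (hc : c = sInf ((fun lam => V lam (fun _ => ωinf)) '' frontier Γcl))
    (β : ℝ) (hβ : 1 < β)
    (Φ : Set ((Fin m → ℝ) × (Fin n → ℝ)))
    (hΦ : Φ = {x | x.1 ∈ Γcl ∧ V x.1 x.2 ≤ c / β})
    -- the solution
    (lam : ℝ → Fin m → ℝ) (ω : ℝ → Fin n → ℝ)
    (hlam : ∀ t ≥ (0 : ℝ), HasDerivAt lam (D.mulVec (ω t)) t)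
    (hω : ∀ t ≥ (0 : ℝ), ∀ i, HasDerivAt (fun s => ω s i)
      ((-E i * ω t i - (∑ j, D j i * Yb j * Real.sin (lam t j)) + p i
        + u i (lam t) (ω t) p) / M i) t)
    -- admissible initial condition in `Φ`
    (h0range : ∃ θ, D.mulVec θ = lam 0)
    (h0Φ : (lam 0, ω 0) ∈ Φ) :
    Filter.Tendsto (fun t => (lam t, ω t)) Filter.atTop
      (nhds (lamInf, fun _ => ωinf)) := by
  have hrow := incidence_row_sum_eq_zero hD
  have hu : ∀ i, Continuous fun x : (Fin m → ℝ) × (Fin n → ℝ) => u i x.1 x.2 p := fun i => by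
    by_cases hi : i ∈ C
    · exact (huLip i hi).continuous
    · simpa only [hu0 i hi] using continuous_const
  have husign : ∀ i a b, (b i - ωinf) * u i a b p ≤ 0 := fun i a b => by
    by_cases hi : i ∈ C
    · rcases eq_or_ne (b i) ωinf with h | h
      · simp [h]
      · exact (huSign i hi a b).1 h
    · simp [hu0 i hi]
  have huinf : ∀ i a, u i a (fun _ => ωinf) p = 0 := fun i a => by
    by_cases hi : i ∈ C
    · exact (huSign i hi a _).2 rfl
    · exact hu0 i hi _ _ _
  have hΓball : Γcl = Metric.closedBall 0 (π / 2) := by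
    ext x
    simp [hΓcl, pi_norm_le_iff_of_nonneg pi_div_two_pos.le]
  have hΓcompact : IsCompact Γcl := hΓball ▸ isCompact_closedBall 0 (π / 2)
  have hWV : ∀ a b, V a b = (1 / 2) * ∑ i, M i * (b i - ωinf) ^ 2 + V a (fun _ => ωinf) :=
    fun a b => by simp [hV]
  have hkin : ∀ b : Fin n → ℝ, 0 ≤ (1 / 2) * ∑ i, M i * (b i - ωinf) ^ 2 := fun b =>
    mul_nonneg (by norm_num) (Finset.sum_nonneg fun i _ => mul_nonneg (hM i).le (sq_nonneg _))
  have hW0 : ∀ a ∈ Γcl, 0 ≤ V a (fun _ => ωinf) := fun a ha => by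
    rw [hΓcl] at ha
    simpa [hV] using Finset.sum_nonneg fun j (_ : j ∈ Finset.univ) =>
      mul_nonneg (hYb j).le (cos_tangent_gap_nonneg (hbound j) (ha j))
  have hlevel : ∀ a ∈ frontier Γcl, c / β < V a (fun _ => ωinf) := fun a ha => by
    have haΓ : a ∈ Γcl := hΓcompact.isClosed.frontier_subset ha
    have hca : c ≤ V a (fun _ => ωinf) := by
      rw [hc]
      refine csInf_le ⟨0, ?_⟩ (Set.mem_image_of_mem _ ha)
      rintro _ ⟨x, hx, rfl⟩
      exact hW0 x (hΓcompact.isClosed.frontier_subset hx)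
    have hne : a ≠ lamInf := by
      rintro rfl
      refine ha.2 (mem_interior.2 ⟨Metric.ball 0 (π / 2),
        hΓball ▸ Metric.ball_subset_closedBall, Metric.isOpen_ball, ?_⟩)
      simpa [pi_norm_lt_iff pi_div_two_pos] using hbound
    obtain ⟨k, hk⟩ := Function.ne_iff.1 hne
    have haΓ' := haΓ
    rw [hΓcl] at haΓ'
    have hpos : 0 < V a (fun _ => ωinf) := by
      simpa [hV] using Finset.sum_pos' (fun j (_ : j ∈ Finset.univ) =>
        mul_nonneg (hYb j).le (cos_tangent_gap_nonneg (hbound j) (haΓ' j)))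
        ⟨k, Finset.mem_univ k, mul_pos (hYb k) (cos_tangent_gap_pos (hbound k) (haΓ' k) hk)⟩
    rcases le_or_gt c 0 with h | h
    · exact (div_nonpos_of_nonpos_of_nonneg h (by linarith)).trans_lt hpos
    · exact (div_lt_self h hβ).trans_le hca
  have hVderiv : ∀ t ≥ 0, HasDerivAt (fun s => V (lam s) (ω s))
      (∑ i, (-(E i * (ω t i - ωinf) ^ 2) + (ω t i - ωinf) * u i (lam t) (ω t) p)) t :=
    fun t ht => by
      rw [hV]
      exact hasDerivAt_energy hM hrow heq (hlam t ht) (hω t ht)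
  have hterm : ∀ t i, -(E i * (ω t i - ωinf) ^ 2) + (ω t i - ωinf) * u i (lam t) (ω t) p
      ≤ -(E i * (ω t i - ωinf) ^ 2) := fun t i => by linarith [husign i (lam t) (ω t)]
  have hterm0 : ∀ t i, -(E i * (ω t i - ωinf) ^ 2) + (ω t i - ωinf) * u i (lam t) (ω t) p ≤ 0 :=
    fun t i => (hterm t i).trans (neg_nonpos.2 (mul_nonneg (hE i).le (sq_nonneg _)))
  rw [hΦ] at h0Φ
  have hVle : ∀ t ≥ 0, V (lam t) (ω t) ≤ c / β := fun t ht => by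
    refine le_trans ?_ h0Φ.2
    refine antitoneOn_of_hasDerivWithinAt_nonpos (f := fun s => V (lam s) (ω s)) (convex_Ici 0)
      (fun s hs => (hVderiv s hs).continuousAt.continuousWithinAt)
      (fun s hs => (hVderiv s (interior_subset hs)).hasDerivWithinAt)
      (fun s _ => Finset.sum_nonpos fun i _ => hterm0 s i) Set.self_mem_Ici ht ht
  have hlamΓ : ∀ t ≥ 0, lam t ∈ Γcl := mem_of_forall_notMem_frontier hΓcompact.isClosed
    (fun t ht => (hlam t ht).continuousAt.continuousWithinAt) h0Φ.1 fun t ht hmem => by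
      linarith [hlevel _ hmem, hVle t ht, hWV (lam t) (ω t), hkin (ω t)]
  obtain ⟨L, hL⟩ := exists_tendsto_of_deriv_nonpos (b := 0) hVderiv
    (fun t _ => Finset.sum_nonpos fun i _ => hterm0 t i) fun t ht => by
      linarith [hWV (lam t) (ω t), hkin (ω t), hW0 _ (hlamΓ t ht)]
  let r : Fin n → ℝ := fun i => 1 + 2 * (c / β) / M i
  let S : Set ((Fin m → ℝ) × (Fin n → ℝ)) :=
    Γcl ×ˢ Set.univ.pi fun i => Set.Icc (ωinf - r i) (ωinf + r i)
  have hS : IsCompact S := hΓcompact.prod (isCompact_univ_pi fun i => isCompact_Icc)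
  have hmemS : ∀ t ≥ 0, (lam t, ω t) ∈ S := fun t ht => by
    refine ⟨hlamΓ t ht, fun i _ => ?_⟩
    have hi : M i * (ω t i - ωinf) ^ 2 ≤ 2 * (c / β) := by
      have := Finset.single_le_sum (f := fun i => M i * (ω t i - ωinf) ^ 2)
        (fun i _ => mul_nonneg (hM i).le (sq_nonneg _)) (Finset.mem_univ i)
      linarith [hVle t ht, hWV (lam t) (ω t), hW0 _ (hlamΓ t ht)]
    have hi' : (ω t i - ωinf) ^ 2 ≤ r i - 1 := by
      rw [add_sub_cancel_left, le_div_iff₀ (hM i)]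
      linarith
    constructor <;> nlinarith [sq_nonneg (ω t i - ωinf - 1), sq_nonneg (ω t i - ωinf + 1)]
  let F : Fin n → (Fin m → ℝ) × (Fin n → ℝ) → ℝ := fun i x =>
    (-E i * x.2 i - (∑ j, D j i * Yb j * sin (x.1 j)) + p i + u i x.1 x.2 p) / M i
  have hF : ∀ i, Continuous (F i) := fun i => by
    have := hu i
    fun_prop
  have hωlim : Filter.Tendsto ω Filter.atTop (nhds fun _ => ωinf) := by
    refine tendsto_pi_nhds.2 fun i => ?_
    refine tendsto_of_dissipation (x := fun t => (lam t, ω t)) (w := fun x => x.2 i) hS hmemS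
      (by fun_prop) (hF i) (fun t ht => hω t ht i) (hE i) hVderiv hL fun t ht => ?_
    refine le_trans ?_ (hterm t i)
    have := Finset.single_le_sum (fun k _ => neg_nonneg.2 (hterm0 t k)) (Finset.mem_univ i)
    rwa [Finset.sum_neg_distrib, neg_le_neg_iff] at this
  let g : Fin n → (Fin m → ℝ) → ℝ := fun i a =>
    (p i - ωinf * E i - ∑ j, D j i * Yb j * sin (a j)) / M i
  have hg : ∀ i, Continuous (g i) := fun i => by fun_prop
  let e : Fin n → (Fin m → ℝ) × (Fin n → ℝ) → ℝ := fun i x =>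
    (-(E i * (x.2 i - ωinf)) + u i x.1 x.2 p) / M i
  have hFge : ∀ i x, F i x = g i x.1 + e i x := fun i x => by
    simp only [F, g, e]
    ring
  have helim : ∀ i, Filter.Tendsto (fun t => e i (lam t, ω t)) Filter.atTop (nhds 0) := fun i => by
    refine tendsto_zero_of_isCompact_of_vanish hΓcompact (G := e i) ?_ (fun a => ?_)
      ((Filter.eventually_ge_atTop 0).mono hlamΓ) hωlim
    · have := hu i
      fun_prop
    · simp [e, huinf]
  have hglip : ∀ i, ∃ K, ∀ s ≥ 0, ∀ t ≥ 0, |g i (lam t) - g i (lam s)| ≤ K * |t - s| := fun i => by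
    refine exists_lipschitz_of_deriv_eq_comp hS hmemS (G := fun x =>
      -(∑ j, D j i * Yb j * (cos (x.1 j) * D.mulVec x.2 j)) / M i) ?_ fun t ht => ?_
    · simp only [Matrix.mulVec, dotProduct]
      fun_prop
    · exact ((HasDerivAt.fun_sum fun j _ => ((hasDerivAt_pi.1 (hlam t ht) j).sin.const_mul
        (D j i * Yb j))).const_sub (p i - ωinf * E i)).div_const (M i)
  have hglim : ∀ i, Filter.Tendsto (fun t => g i (lam t)) Filter.atTop (nhds 0) := fun i => by
    obtain ⟨K, hK⟩ := hglip i
    have hωi := tendsto_pi_nhds.1 hωlim i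
    rw [Metric.tendsto_nhds]
    intro ε hε
    have hupper := eventually_lt_of_deriv_le_neg_add (fun t ht => (hω t ht i).neg) hωi.neg
      (g := fun t => g i (lam t)) (e := fun t => -e i (lam t, ω t))
      (fun t _ => by linarith [hFge i (lam t, ω t)]) (by simpa using (helim i).neg) hK hε
    have hlower := eventually_lt_of_deriv_le_neg_add (fun t ht => hω t ht i) hωi
      (g := fun t => -g i (lam t)) (e := fun t => e i (lam t, ω t)) (K := K)
      (fun t _ => by linarith [hFge i (lam t, ω t)]) (helim i)
      (fun s hs t ht => by
        rw [neg_sub_neg, abs_sub_comm]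
        exact hK s hs t ht) hε
    filter_upwards [hupper, hlower] with t h1 h2
    rw [Real.dist_0_eq_abs, abs_lt]
    constructor <;> linarith
  have hlamrange : ∀ t ≥ 0, lam t ∈ LinearMap.range D.mulVecLin :=
    mem_submodule_of_hasDerivAt hlam (fun t _ => ⟨ω t, rfl⟩) h0range
  have hlamlim : Filter.Tendsto lam Filter.atTop (nhds lamInf) := by
    refine hΓcompact.tendsto_nhds_of_unique_mapClusterPt
      ((Filter.eventually_ge_atTop 0).mono hlamΓ) fun a ha hcl => ?_
    refine huniq a (by rwa [hΓcl] at ha) ?_ fun i => ?_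
    · exact (Submodule.closed_of_finiteDimensional _).mem_of_mapClusterPt hcl
        ((Filter.eventually_ge_atTop 0).mono hlamrange)
    · have hga : g i a = 0 := by
        have h := hcl.continuousAt_comp (hg i).continuousAt
        exact eq_of_nhds_neBot (ClusterPt.mono h (hglim i))
      rw [div_eq_zero_iff, or_iff_left (hM i).ne'] at hga
      linarith
  exact hlamlim.prodMk_nhds hωlim
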